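/- Let α be a partial action of a group G on a k-algebra A such that Ann(A_t, A) = {0} for every t ∈ G (this holds in particular when each ideal A_t is unital). Then any two enveloping pairs of α with trivial annihilator are isomorphic. -/

import Mathlib

set_option linter.unusedSectionVars false
set_option linter.unusedVariables false

universe u v w x y

section PartialActionPrelim

variable (k : Type u) [CommRing k] (G : Type v) [Group G] (A : Type w)
  [NonUnitalRing A] [Module k A] [SMulCommClass k A A] [IsScalarTower k A A]

/-- A partial action of a group `G` on a (not necessarily unital) `k`-algebra `A`:
a family of two-sided ideals `A_t` and algebra isomorphisms `α_t : A_{t⁻¹} → A_t`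
(encoded by total functions `act t : A → A` whose behaviour only matters on `A_{t⁻¹}`). -/
structure AlgPartialAction : Type (max u v w) where
  ideal : G → Submodule k A
  act : G → A → A
  mul_mem_left : ∀ (t : G) (a : A), ∀ x ∈ ideal t, a * x ∈ ideal t
  mul_mem_right : ∀ (t : G) (a : A), ∀ x ∈ ideal t, x * a ∈ ideal t
  ideal_one : ideal 1 = ⊤
  act_one : ∀ a : A, act 1 a = a
  act_mem : ∀ t : G, ∀ a ∈ ideal t⁻¹, act t a ∈ ideal t
  act_add : ∀ t : G, ∀ a ∈ ideal t⁻¹, ∀ b ∈ ideal t⁻¹, act t (a + b) = act t a + act t b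
  act_smul : ∀ (t : G) (c : k), ∀ a ∈ ideal t⁻¹, act t (c • a) = c • act t a
  act_mul : ∀ t : G, ∀ a ∈ ideal t⁻¹, ∀ b ∈ ideal t⁻¹, act t (a * b) = act t a * act t b
  act_injOn : ∀ t : G, Set.InjOn (act t) (ideal t⁻¹ : Set A)
  act_image : ∀ s t : G,
    act t '' ((ideal t⁻¹ : Set A) ∩ (ideal s : Set A)) = (ideal t : Set A) ∩ (ideal (t * s) : Set A)
  act_comp : ∀ s t : G, ∀ a ∈ ideal t⁻¹, act t a ∈ ideal s⁻¹ → act s (act t a) = act (s * t) a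

/-- The annihilator `Ann(B) = {b ∈ B : bB = Bb = 0}`. -/
def annih (B : Type x) [NonUnitalRing B] : Set B := {b | ∀ c : B, b * c = 0 ∧ c * b = 0}

variable {k G A}

/-- An enveloping pair `(μ, β)` for a partial action `α`: a global action `β` of `G` on `B`,
an injective algebra homomorphism `μ : A → B` whose range is an ideal, with
`μ(A_t) = μ(A) ∩ β_t(μ(A))`, `β_t ∘ μ = μ ∘ α_t` on `A_{t⁻¹}`, and
`span {β_t(μ(A)) : t ∈ G} = B`. -/
structure EnvPair (α : AlgPartialAction k G A) (B : Type x) [NonUnitalRing B]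
    [Module k B] [SMulCommClass k B B] [IsScalarTower k B B] : Type (max u v w x) where
  β : G → B →ₙₐ[k] B
  β_one : ∀ b : B, β 1 b = b
  β_comp : ∀ (s t : G) (b : B), β (s * t) b = β s (β t b)
  μ : A →ₙₐ[k] B
  μ_inj : Function.Injective μ
  μ_mul_mem_left : ∀ b : B, ∀ x ∈ Set.range μ, b * x ∈ Set.range μ
  μ_mul_mem_right : ∀ b : B, ∀ x ∈ Set.range μ, x * b ∈ Set.range μ
  inter : ∀ t : G, ⇑μ '' (α.ideal t : Set A) = Set.range μ ∩ (⇑(β t) '' Set.range μ)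
  equivar : ∀ t : G, ∀ a ∈ α.ideal t⁻¹, β t (μ a) = μ (α.act t a)
  spans : Submodule.span k (⋃ t : G, ⇑(β t) '' Set.range μ) = ⊤

/-- An isomorphism of enveloping pairs: an algebra isomorphism `φ` intertwining the global
actions with `φ ∘ μ = ν`. -/
def IsEnvPairIso {α : AlgPartialAction k G A} {B : Type x} [NonUnitalRing B]
    [Module k B] [SMulCommClass k B B] [IsScalarTower k B B]
    {C : Type y} [NonUnitalRing C] [Module k C] [SMulCommClass k C C] [IsScalarTower k C C]
    (P : EnvPair α B) (Q : EnvPair α C) (φ : B → C) : Prop :=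
  Function.Bijective φ ∧ (∀ x y : B, φ (x + y) = φ x + φ y) ∧
    (∀ x y : B, φ (x * y) = φ x * φ y) ∧ (∀ (c : k) (x : B), φ (c • x) = c • φ x) ∧
    (∀ (t : G) (b : B), φ (P.β t b) = Q.β t (φ b)) ∧ ∀ a : A, φ (P.μ a) = Q.μ a

/-- An enveloping family of functions for a partial action `α` (Definition 1.7). -/
structure IsEnvFamily (α : AlgPartialAction k G A) (F : G → A → A → A) : Prop where
  mem : ∀ (t : G) (a b : A), F t a b ∈ α.ideal t
  add_left : ∀ (t : G) (a a' b : A), F t (a + a') b = F t a b + F t a' b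
  add_right : ∀ (t : G) (a b b' : A), F t a (b + b') = F t a b + F t a b'
  smul_left : ∀ (t : G) (c : k) (a b : A), F t (c • a) b = c • F t a b
  smul_right : ∀ (t : G) (c : k) (a b : A), F t a (c • b) = c • F t a b
  F_one : ∀ a b : A, F 1 a b = a * b
  cond2a : ∀ (t : G) (a b c : A), F t a (b * c) = F t a b * c
  cond2b : ∀ (t : G) (a b c : A), α.act t (F t⁻¹ (a * b) c) = a * α.act t (F t⁻¹ b c)
  cond2c : ∀ (t : G) (a b c : A), a * F t b c = α.act t (F t⁻¹ a b) * c
  cond3a : ∀ (s t : G) (a b c : A), F t (F s a b) c = F (t * s) a (F t b c)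
  cond3b : ∀ (s t : G) (a b c : A), F t (α.act s⁻¹ (F s a b)) c = F t a (F (t * s⁻¹) b c)
  cond4 : ∀ a : A, a = 0 ↔ ∀ (t : G) (b : A), F t a b = 0 ∧ F t b a = 0
  cond5a : ∀ (s t : G) (b : A), ∀ a ∈ α.ideal t⁻¹, F (s * t) a b = F s (α.act t a) b
  cond5b : ∀ (s t : G) (b : A), ∀ a ∈ α.ideal t⁻¹,
    α.act (s * t) (F (t⁻¹ * s⁻¹) b a) = α.act s (F s⁻¹ b (α.act t a))
  cond6 : ∀ (t : G) (a : A),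
    (∃ b : A, ∀ (s : G) (c : A), F s a c = F (s * t) b c ∧ F s c a = α.act t (F (t⁻¹ * s) c b)) →
    a ∈ α.ideal t

end PartialActionPrelim

section MultiplierPrelim

variable (k : Type u) [CommRing k] (M : Type x) [NonUnitalRing M]
  [Module k M] [SMulCommClass k M M] [IsScalarTower k M M]

/-- A multiplier of a non-unital algebra `M`: a pair `(L, R)` of linear maps with
`L(fg) = L(f)g`, `R(fg) = fR(g)` and `fL(g) = R(f)g`. -/
structure Multiplier : Type (max u x) where
  L : M →ₗ[k] M
  R : M →ₗ[k] M
  L_mul : ∀ f g : M, L (f * g) = L f * g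
  R_mul : ∀ f g : M, R (f * g) = f * R g
  cross : ∀ f g : M, f * L g = R f * g

namespace Multiplier

variable {k M}

@[ext] lemma ext {m n : Multiplier k M} (hL : m.L = n.L) (hR : m.R = n.R) : m = n := by
  cases m; cases n; simp_all

instance : Zero (Multiplier k M) :=
  ⟨⟨0, 0, by simp, by simp, by simp⟩⟩

instance : Add (Multiplier k M) :=
  ⟨fun m n =>
    ⟨m.L + n.L, m.R + n.R,
      by intro f g; simp [m.L_mul, n.L_mul, add_mul],
      by intro f g; simp [m.R_mul, n.R_mul, mul_add],
      by intro f g; simp [m.cross, n.cross, mul_add, add_mul]⟩⟩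

instance : Neg (Multiplier k M) :=
  ⟨fun m =>
    ⟨-m.L, -m.R,
      by intro f g; simp [m.L_mul, neg_mul],
      by intro f g; simp [m.R_mul, mul_neg],
      by intro f g; simp [m.cross, mul_neg, neg_mul]⟩⟩

instance : SMul k (Multiplier k M) :=
  ⟨fun c m =>
    ⟨c • m.L, c • m.R,
      by intro f g; simp [m.L_mul, smul_mul_assoc],
      by intro f g; simp [m.R_mul, mul_smul_comm],
      by intro f g; simp [m.cross, mul_smul_comm, smul_mul_assoc]⟩⟩

instance : Mul (Multiplier k M) :=
  ⟨fun m n =>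
    ⟨m.L ∘ₗ n.L, n.R ∘ₗ m.R,
      by intro f g; simp [n.L_mul, m.L_mul],
      by intro f g; simp [m.R_mul, n.R_mul],
      by intro f g; simp [m.cross, n.cross]⟩⟩

@[simp] lemma zero_L : (0 : Multiplier k M).L = 0 := rfl
@[simp] lemma zero_R : (0 : Multiplier k M).R = 0 := rfl
@[simp] lemma add_L (m n : Multiplier k M) : (m + n).L = m.L + n.L := rfl
@[simp] lemma add_R (m n : Multiplier k M) : (m + n).R = m.R + n.R := rfl
@[simp] lemma neg_L (m : Multiplier k M) : (-m).L = -m.L := rfl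
@[simp] lemma neg_R (m : Multiplier k M) : (-m).R = -m.R := rfl
@[simp] lemma smul_L (c : k) (m : Multiplier k M) : (c • m).L = c • m.L := rfl
@[simp] lemma smul_R (c : k) (m : Multiplier k M) : (c • m).R = c • m.R := rfl
@[simp] lemma mul_L (m n : Multiplier k M) : (m * n).L = m.L ∘ₗ n.L := rfl
@[simp] lemma mul_R (m n : Multiplier k M) : (m * n).R = n.R ∘ₗ m.R := rfl

instance : AddCommGroup (Multiplier k M) where
  add_assoc a b c := by ext <;> simp [add_assoc]
  zero_add a := by ext <;> simp
  add_zero a := by ext <;> simp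
  add_comm a b := by ext <;> simp [add_comm]
  neg_add_cancel a := by ext <;> simp
  nsmul := nsmulRec
  zsmul := zsmulRec

instance : Module k (Multiplier k M) where
  one_smul m := by ext <;> simp
  mul_smul c d m := by ext <;> simp [mul_smul]
  smul_zero c := by ext <;> simp
  smul_add c m n := by ext <;> simp
  add_smul c d m := by ext <;> simp [add_smul]
  zero_smul m := by ext <;> simp

end Multiplier

end MultiplierPrelim

section AdPrelim

variable (k : Type u) [CommRing k] (G : Type v) [Group G] (A : Type w)
  [NonUnitalRing A] [Module k A] [SMulCommClass k A A] [IsScalarTower k A A]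

/-- The left-translation representation `λ_s f (r) = f (s⁻¹ r)` of `G` on `F(G,A)`. -/
def lamRep (s : G) : (G → A) →ₗ[k] (G → A) where
  toFun f := fun r => f (s⁻¹ * r)
  map_add' f g := rfl
  map_smul' c f := rfl

@[simp] lemma lamRep_apply (s : G) (f : G → A) (r : G) : lamRep k G A s f r = f (s⁻¹ * r) := rfl

/-- The global action `Ad` of `G` on the multiplier algebra `M(F(G,A))`. -/
def AdAct (s : G) (m : Multiplier k (G → A)) : Multiplier k (G → A) where
  L := lamRep k G A s ∘ₗ m.L ∘ₗ lamRep k G A s⁻¹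
  R := lamRep k G A s ∘ₗ m.R ∘ₗ lamRep k G A s⁻¹
  L_mul f g := by
    have h : lamRep k G A s⁻¹ (f * g) = lamRep k G A s⁻¹ f * lamRep k G A s⁻¹ g := rfl
    funext r
    simp only [LinearMap.comp_apply, h, m.L_mul, lamRep_apply, Pi.mul_apply]
    simp
  R_mul f g := by
    have h : lamRep k G A s⁻¹ (f * g) = lamRep k G A s⁻¹ f * lamRep k G A s⁻¹ g := rfl
    funext r
    simp only [LinearMap.comp_apply, h, m.R_mul, lamRep_apply, Pi.mul_apply]
    simp
  cross f g := by
    have h := m.cross (lamRep k G A s⁻¹ f) (lamRep k G A s⁻¹ g)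
    funext r
    have h' := congrFun h (s⁻¹ * r)
    simp only [Pi.mul_apply, lamRep_apply, LinearMap.comp_apply] at h' ⊢
    simpa using h'

@[simp] lemma AdAct_L (s : G) (m : Multiplier k (G → A)) :
    (AdAct k G A s m).L = lamRep k G A s ∘ₗ m.L ∘ₗ lamRep k G A s⁻¹ := rfl
@[simp] lemma AdAct_R (s : G) (m : Multiplier k (G → A)) :
    (AdAct k G A s m).R = lamRep k G A s ∘ₗ m.R ∘ₗ lamRep k G A s⁻¹ := rfl

end AdPrelim

section EnvPairUniqueness

variable {k : Type u} [CommRing k] {G : Type v} [Group G] {A : Type w}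
  [NonUnitalRing A] [Module k A] [SMulCommClass k A A] [IsScalarTower k A A]
  {α : AlgPartialAction k G A}
  {B : Type x} [NonUnitalRing B] [Module k B] [SMulCommClass k B B] [IsScalarTower k B B]
  {C : Type y} [NonUnitalRing C] [Module k C] [SMulCommClass k C C] [IsScalarTower k C C]

namespace AlgPartialAction

lemma act_inv_mem (α : AlgPartialAction k G A) {t : G} {a : A} (ha : a ∈ α.ideal t) :
    α.act t⁻¹ a ∈ α.ideal t⁻¹ :=
  α.act_mem t⁻¹ a (by rwa [inv_inv])

end AlgPartialAction

namespace EnvPair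

lemma β_inv_apply (P : EnvPair α B) (t : G) (b : B) : P.β t⁻¹ (P.β t b) = b := by
  rw [← P.β_comp, inv_mul_cancel, P.β_one]

lemma β_apply_inv (P : EnvPair α B) (t : G) (b : B) : P.β t (P.β t⁻¹ b) = b := by
  rw [← P.β_comp, mul_inv_cancel, P.β_one]

lemma β_injective (P : EnvPair α B) (t : G) : Function.Injective (P.β t) :=
  Function.LeftInverse.injective (P.β_inv_apply t)

lemma β_μ_act_inv (P : EnvPair α B) {t : G} {a : A} (ha : a ∈ α.ideal t) :
    P.β t (P.μ (α.act t⁻¹ a)) = P.μ a := by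
  rw [← P.equivar t⁻¹ a (by rwa [inv_inv]), P.β_apply_inv]

lemma exists_β_μ_mul_μ (P : EnvPair α B) (t : G) (a b : A) :
    ∃ c ∈ α.ideal t, P.β t (P.μ a) * P.μ b = P.μ c := by
  have h : P.β t (P.μ a) * P.μ b ∈ ⇑P.μ '' (α.ideal t : Set A) := by
    rw [P.inter t]
    refine ⟨P.μ_mul_mem_left _ _ ⟨b, rfl⟩, P.μ a * P.β t⁻¹ (P.μ b),
      P.μ_mul_mem_right _ _ ⟨a, rfl⟩, ?_⟩
    rw [map_mul, P.β_apply_inv]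
  obtain ⟨c, hc, h⟩ := h
  exact ⟨c, hc, h.symm⟩

lemma mul_eq_of_β_μ_mul_μ (P : EnvPair α B) {t : G} {a b c : A}
    (h : P.β t (P.μ a) * P.μ b = P.μ c) {z : A} (hz : z ∈ α.ideal t) :
    c * z = α.act t (a * α.act t⁻¹ (b * z)) := by
  have hbz := α.mul_mem_left t b z hz
  apply P.μ_inj
  rw [map_mul, ← h, mul_assoc, ← map_mul, ← P.β_μ_act_inv hbz, ← map_mul, ← map_mul,
    P.equivar t _ (α.mul_mem_left _ _ _ (α.act_inv_mem hbz))]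

lemma mul_eq_of_β_μ_mul_μ' (P : EnvPair α B) {t : G} {a b c : A}
    (h : P.β t (P.μ a) * P.μ b = P.μ c) {z : A} (hz : z ∈ α.ideal t) :
    z * c = α.act t (α.act t⁻¹ z * a) * b := by
  apply P.μ_inj
  rw [map_mul, ← h, ← mul_assoc, ← P.β_μ_act_inv hz, ← map_mul, ← map_mul,
    P.equivar t _ (α.mul_mem_right _ _ _ (α.act_inv_mem hz)), ← map_mul]

/-- When the ideals `A_t` have trivial annihilator, the products `β_t(μ(a)) μ(b)` are determined
by the partial action. -/
lemma exists_common_β_μ_mul_μ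
    (hA : ∀ t : G, {a : A | ∀ x ∈ α.ideal t, a * x = 0 ∧ x * a = 0} = {0})
    (P : EnvPair α B) (Q : EnvPair α C) (t : G) (a b : A) :
    ∃ c ∈ α.ideal t, P.β t (P.μ a) * P.μ b = P.μ c ∧ Q.β t (Q.μ a) * Q.μ b = Q.μ c := by
  obtain ⟨c, hc, hP⟩ := P.exists_β_μ_mul_μ t a b
  obtain ⟨d, -, hQ⟩ := Q.exists_β_μ_mul_μ t a b
  have hcd : c - d ∈ ({0} : Set A) := by
    rw [← hA t]
    intro z hz
    rw [sub_mul, mul_sub, P.mul_eq_of_β_μ_mul_μ hP hz, Q.mul_eq_of_β_μ_mul_μ hQ hz,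
      P.mul_eq_of_β_μ_mul_μ' hP hz, Q.mul_eq_of_β_μ_mul_μ' hQ hz, sub_self, sub_self]
    exact ⟨rfl, rfl⟩
  obtain rfl : c = d := sub_eq_zero.mp hcd
  exact ⟨c, hc, hP, hQ⟩

lemma exists_common_β_μ_mul_β_μ
    (hA : ∀ t : G, {a : A | ∀ x ∈ α.ideal t, a * x = 0 ∧ x * a = 0} = {0})
    (P : EnvPair α B) (Q : EnvPair α C) (s t : G) (a b : A) :
    ∃ c ∈ α.ideal (t⁻¹ * s), P.β s (P.μ a) * P.β t (P.μ b) = P.β t (P.μ c) ∧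
      Q.β s (Q.μ a) * Q.β t (Q.μ b) = Q.β t (Q.μ c) := by
  obtain ⟨c, hc, hP, hQ⟩ := exists_common_β_μ_mul_μ hA P Q (t⁻¹ * s) a b
  refine ⟨c, hc, ?_, ?_⟩
  · rw [← hP, map_mul, ← P.β_comp, mul_inv_cancel_left]
  · rw [← hQ, map_mul, ← Q.β_comp, mul_inv_cancel_left]

/-- The span of the pairs `(β_t(μ(a)), γ_t(ν(a)))`; it is the graph of the isomorphism between two
enveloping pairs. -/
def isoGraph (P : EnvPair α B) (Q : EnvPair α C) : Submodule k (B × C) :=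
  Submodule.span k (Set.range fun p : G × A => (P.β p.1 (P.μ p.2), Q.β p.1 (Q.μ p.2)))

lemma mem_isoGraph (P : EnvPair α B) (Q : EnvPair α C) (t : G) (a : A) :
    (P.β t (P.μ a), Q.β t (Q.μ a)) ∈ isoGraph P Q :=
  Submodule.subset_span ⟨(t, a), rfl⟩

@[elab_as_elim]
lemma isoGraph_induction {P : EnvPair α B} {Q : EnvPair α C}
    {motive : (b : B) → (c : C) → (b, c) ∈ isoGraph P Q → Prop}
    (basic : ∀ t a, motive (P.β t (P.μ a)) (Q.β t (Q.μ a)) (mem_isoGraph P Q t a))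
    (zero : motive 0 0 (zero_mem _))
    (add : ∀ b c b' c' h h', motive b c h → motive b' c' h' →
      motive (b + b') (c + c') (add_mem h h'))
    (smul : ∀ (r : k) b c h, motive b c h →
      motive (r • b) (r • c) (Submodule.smul_mem _ r h))
    {b : B} {c : C} (h : (b, c) ∈ isoGraph P Q) : motive b c h := by
  have key : ∀ p (hp : p ∈ isoGraph P Q), motive p.1 p.2 hp := by
    intro p hp
    induction hp using Submodule.span_induction with
    | mem p hp => obtain ⟨⟨t, a⟩, rfl⟩ := hp; exact basic t a
    | zero => exact zero
    | add p q hp hq h h' => exact add _ _ _ _ hp hq h h'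
    | smul r p hp h => exact smul r _ _ hp h
  exact key _ h

lemma swap_mem_isoGraph {P : EnvPair α B} {Q : EnvPair α C} {b : B} {c : C}
    (h : (b, c) ∈ isoGraph P Q) : (c, b) ∈ isoGraph Q P := by
  induction h using isoGraph_induction with
  | basic t a => exact mem_isoGraph Q P t a
  | zero => exact zero_mem _
  | add _ _ _ _ _ _ h h' => exact add_mem h h'
  | smul r _ _ _ h => exact Submodule.smul_mem _ r h

lemma β_mem_isoGraph {P : EnvPair α B} {Q : EnvPair α C} {b : B} {c : C}
    (h : (b, c) ∈ isoGraph P Q) (s : G) : (P.β s b, Q.β s c) ∈ isoGraph P Q := by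
  induction h using isoGraph_induction with
  | basic t a => rw [← P.β_comp, ← Q.β_comp]; exact mem_isoGraph P Q _ a
  | zero => rw [map_zero, map_zero]; exact zero_mem _
  | add _ _ _ _ _ _ h h' => rw [map_add, map_add]; exact add_mem h h'
  | smul r _ _ _ h => rw [map_smul, map_smul]; exact Submodule.smul_mem _ r h

lemma span_induction (P : EnvPair α B) {motive : B → Prop}
    (basic : ∀ t a, motive (P.β t (P.μ a))) (zero : motive 0)
    (add : ∀ b c, motive b → motive c → motive (b + c))
    (smul : ∀ (r : k) b, motive b → motive (r • b)) (b : B) : motive b := by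
  have hb : b ∈ Submodule.span k (⋃ t : G, ⇑(P.β t) '' Set.range P.μ) := by
    rw [P.spans]; trivial
  induction hb using Submodule.span_induction with
  | mem b hb =>
    obtain ⟨t, _, ⟨a, rfl⟩, rfl⟩ := Set.mem_iUnion.mp hb
    exact basic t a
  | zero => exact zero
  | add b c _ _ hb hc => exact add _ _ hb hc
  | smul r b _ hb => exact smul r _ hb

lemma exists_mem_isoGraph (P : EnvPair α B) (Q : EnvPair α C) (b : B) :
    ∃ c, (b, c) ∈ isoGraph P Q := by
  induction b using P.span_induction with
  | basic t a => exact ⟨_, mem_isoGraph P Q t a⟩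
  | zero => exact ⟨0, zero_mem _⟩
  | add b b' h h' =>
    obtain ⟨c, hc⟩ := h
    obtain ⟨c', hc'⟩ := h'
    exact ⟨c + c', add_mem hc hc'⟩
  | smul r b h =>
    obtain ⟨c, hc⟩ := h
    exact ⟨r • c, Submodule.smul_mem _ r hc⟩

lemma exists_common_mul_β_μ
    (hA : ∀ t : G, {a : A | ∀ x ∈ α.ideal t, a * x = 0 ∧ x * a = 0} = {0})
    {P : EnvPair α B} {Q : EnvPair α C} {b : B} {c : C} (h : (b, c) ∈ isoGraph P Q)
    (t : G) (a : A) :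
    ∃ d, b * P.β t (P.μ a) = P.β t (P.μ d) ∧ c * Q.β t (Q.μ a) = Q.β t (Q.μ d) := by
  induction h using isoGraph_induction with
  | basic s e =>
    obtain ⟨d, -, hd⟩ := exists_common_β_μ_mul_β_μ hA P Q s t e a
    exact ⟨d, hd⟩
  | zero => exact ⟨0, by simp, by simp⟩
  | add _ _ _ _ _ _ h h' =>
    obtain ⟨d, hP, hQ⟩ := h
    obtain ⟨d', hP', hQ'⟩ := h'
    exact ⟨d + d', by simp [add_mul, hP, hP'], by simp [add_mul, hQ, hQ']⟩
  | smul r _ _ _ h =>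
    obtain ⟨d, hP, hQ⟩ := h
    exact ⟨r • d, by simp [smul_mul_assoc, hP], by simp [smul_mul_assoc, hQ]⟩

lemma exists_common_β_μ_mul
    (hA : ∀ t : G, {a : A | ∀ x ∈ α.ideal t, a * x = 0 ∧ x * a = 0} = {0})
    {P : EnvPair α B} {Q : EnvPair α C} {b : B} {c : C} (h : (b, c) ∈ isoGraph P Q)
    (t : G) (a : A) :
    ∃ d, P.β t (P.μ a) * b = P.β t (P.μ d) ∧ Q.β t (Q.μ a) * c = Q.β t (Q.μ d) := by
  induction h using isoGraph_induction with
  | basic s e =>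
    obtain ⟨d, hd, hP, hQ⟩ := exists_common_β_μ_mul_β_μ hA P Q t s a e
    have hd' : d ∈ α.ideal (t⁻¹ * s)⁻¹ := by rwa [mul_inv_rev, inv_inv]
    refine ⟨α.act (t⁻¹ * s) d, ?_, ?_⟩
    · rw [hP, ← P.equivar _ _ hd', ← P.β_comp, mul_inv_cancel_left]
    · rw [hQ, ← Q.equivar _ _ hd', ← Q.β_comp, mul_inv_cancel_left]
  | zero => exact ⟨0, by simp, by simp⟩
  | add _ _ _ _ _ _ h h' =>
    obtain ⟨d, hP, hQ⟩ := h
    obtain ⟨d', hP', hQ'⟩ := h'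
    exact ⟨d + d', by simp [mul_add, hP, hP'], by simp [mul_add, hQ, hQ']⟩
  | smul r _ _ _ h =>
    obtain ⟨d, hP, hQ⟩ := h
    exact ⟨r • d, by simp [mul_smul_comm, hP], by simp [mul_smul_comm, hQ]⟩

lemma mul_mem_isoGraph
    (hA : ∀ t : G, {a : A | ∀ x ∈ α.ideal t, a * x = 0 ∧ x * a = 0} = {0})
    {P : EnvPair α B} {Q : EnvPair α C} {b b' : B} {c c' : C} (h : (b, c) ∈ isoGraph P Q)
    (h' : (b', c') ∈ isoGraph P Q) : (b * b', c * c') ∈ isoGraph P Q := by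
  induction h' using isoGraph_induction with
  | basic t a =>
    obtain ⟨d, hP, hQ⟩ := exists_common_mul_β_μ hA h t a
    rw [hP, hQ]
    exact mem_isoGraph P Q t d
  | zero => rw [mul_zero, mul_zero]; exact zero_mem _
  | add _ _ _ _ _ _ h h' => rw [mul_add, mul_add]; exact add_mem h h'
  | smul r _ _ _ h => rw [mul_smul_comm, mul_smul_comm]; exact Submodule.smul_mem _ r h

lemma eq_zero_of_zero_mem_isoGraph
    (hA : ∀ t : G, {a : A | ∀ x ∈ α.ideal t, a * x = 0 ∧ x * a = 0} = {0})
    {P : EnvPair α B} {Q : EnvPair α C} (hC : annih C = {0}) {c : C}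
    (h : (0, c) ∈ isoGraph P Q) : c = 0 := by
  have eq_zero : ∀ (t : G) (d : A), P.β t (P.μ d) = 0 → d = 0 := fun t d hd =>
    P.μ_inj (P.β_injective t (by rw [hd, map_zero, map_zero]))
  have hc : c ∈ annih C := by
    intro z
    induction z using Q.span_induction with
    | basic t a =>
      obtain ⟨d, hP, hQ⟩ := exists_common_mul_β_μ hA h t a
      obtain ⟨e, hP', hQ'⟩ := exists_common_β_μ_mul hA h t a
      rw [zero_mul] at hP
      rw [mul_zero] at hP'
      rw [hQ, hQ', eq_zero t d hP.symm, eq_zero t e hP'.symm]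
      simp
    | zero => simp
    | add z z' hz hz' => simp [mul_add, add_mul, hz, hz']
    | smul r z hz => simp [mul_smul_comm, smul_mul_assoc, hz]
  rwa [hC] at hc

lemma isoGraph_right_unique
    (hA : ∀ t : G, {a : A | ∀ x ∈ α.ideal t, a * x = 0 ∧ x * a = 0} = {0})
    {P : EnvPair α B} {Q : EnvPair α C} (hC : annih C = {0}) {b : B} {c c' : C}
    (h : (b, c) ∈ isoGraph P Q) (h' : (b, c') ∈ isoGraph P Q) : c = c' := by
  have hsub := sub_mem h h'
  rw [Prod.mk_sub_mk, sub_self] at hsub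
  exact sub_eq_zero.mp (eq_zero_of_zero_mem_isoGraph hA hC hsub)

end EnvPair

end EnvPairUniqueness

/-- **Corollary 1.8.** If `α` is a partial action of `G` on `A` with
`Ann(A_t, A) = {0}` for every `t ∈ G` (which holds in particular when each `A_t` is unital),
then any two enveloping pairs of `α` with trivial annihilator are isomorphic. -/
theorem envPair_unique_of_trivial_ideal_annihilators
    {k : Type u} [CommRing k] {G : Type v} [Group G] {A : Type w}
    [NonUnitalRing A] [Module k A] [SMulCommClass k A A] [IsScalarTower k A A]
    (α : AlgPartialAction k G A)
    (hA : ∀ t : G, {a : A | ∀ x ∈ α.ideal t, a * x = 0 ∧ x * a = 0} = {0})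
    {B : Type x} [NonUnitalRing B] [Module k B] [SMulCommClass k B B] [IsScalarTower k B B]
    {C : Type y} [NonUnitalRing C] [Module k C] [SMulCommClass k C C] [IsScalarTower k C C]
    (P : EnvPair α B) (Q : EnvPair α C)
    (hAnnB : annih B = {0}) (hAnnC : annih C = {0}) :
    ∃ φ : B → C, IsEnvPairIso P Q φ := by
  choose φ hφ using EnvPair.exists_mem_isoGraph P Q
  have φ_eq : ∀ {b : B} {c : C}, (b, c) ∈ EnvPair.isoGraph P Q → φ b = c := fun h =>
    EnvPair.isoGraph_right_unique hA hAnnC (hφ _) h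
  refine ⟨φ, ⟨fun b b' h => ?_, fun c => ?_⟩, fun b b' => φ_eq (add_mem (hφ b) (hφ b')),
    fun b b' => φ_eq (EnvPair.mul_mem_isoGraph hA (hφ b) (hφ b')),
    fun r b => φ_eq (Submodule.smul_mem _ r (hφ b)),
    fun t b => φ_eq (EnvPair.β_mem_isoGraph (hφ b) t), fun a => φ_eq ?_⟩
  · exact EnvPair.isoGraph_right_unique hA hAnnB (EnvPair.swap_mem_isoGraph (hφ b))
      (h ▸ EnvPair.swap_mem_isoGraph (hφ b'))
  · obtain ⟨b, hb⟩ := EnvPair.exists_mem_isoGraph Q P c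
    exact ⟨b, φ_eq (EnvPair.swap_mem_isoGraph hb)⟩
  · simpa only [P.β_one, Q.β_one] using EnvPair.mem_isoGraph P Q 1 a
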